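/- Let w = s_{i₁}⋯s_{i_k} be a word over {s_1,…,s_{n−1}}, and let π be the permutation of {1,…,n} given by the composite σ_{i₁}∘⋯? applied left to right, i.e. π = σ_{i₁} first, then σ_{i₂}, …, then σ_{i_k}, where σ_m is the transposition interchanging m and m+1. Then for all 1 ≤ r ≤ n and all 1 ≤ i < j ≤ n: w⁻¹ ε_r w ≈ ε_{π(r)} and w⁻¹ τ_{ij} w ≈ τ_{π(i), π(j)} (τ indexed symmetrically). -/

import Mathlib

namespace PaperFormal


/-- The alphabet `Y`: letters `s_1,…,s_{n-1}` (the letter `s i` for `i : Fin (n-1)`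
represents `s_{i+1}`, i.e. indices are 0-based), `e` and `t`. -/
inductive YA (n : ℕ) : Type where
  | s (i : Fin (n - 1))
  | e
  | t

/-- The one-letter word `s_{i+1}` (0-based index `i`). -/
def S {n : ℕ} (i : Fin (n - 1)) : FreeMonoid (YA n) := FreeMonoid.of (YA.s i)

/-- The one-letter word `e`. -/
def Ew {n : ℕ} : FreeMonoid (YA n) := FreeMonoid.of YA.e

/-- The one-letter word `t`. -/
def Tw {n : ℕ} : FreeMonoid (YA n) := FreeMonoid.of YA.t

/-- The defining relations (R11)–(R21), with 0-based indexing of the `s i`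
(so the paper's `s_1` is `S i` with `i.val = 0`, etc.). -/
inductive YRel {n : ℕ} : FreeMonoid (YA n) → FreeMonoid (YA n) → Prop
  | r11 (i) : YRel (S i * S i) 1
  | r12 (i j : Fin (n - 1)) (h : i.val + 1 < j.val ∨ j.val + 1 < i.val) :
      YRel (S i * S j) (S j * S i)
  | r13 (i j : Fin (n - 1)) (h : i.val + 1 = j.val ∨ j.val + 1 = i.val) :
      YRel (S i * S j * S i) (S j * S i * S j)
  | r14a : YRel (Ew * Ew) Ew
  | r14b : YRel (Ew * Tw * Ew) Ew
  | r15a : YRel (Tw * Tw) Tw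
  | r15b : YRel (Tw * Ew * Tw) Tw
  | r15c (i) (h : i.val = 0) : YRel (Tw * S i) Tw
  | r15d (i) (h : i.val = 0) : YRel (S i * Tw) Tw
  | r16 (i) (h : 1 ≤ i.val) : YRel (Ew * S i) (S i * Ew)
  | r17 (i) (h : 2 ≤ i.val) : YRel (Tw * S i) (S i * Tw)
  | r18a (a) (ha : a.val = 0) : YRel (S a * Ew * S a * Ew) Ew
  | r18b (a) (ha : a.val = 0) : YRel (S a * Ew * S a) (Ew * S a * Ew)
  | r19 (b) (hb : b.val = 1) : YRel (Tw * S b * Tw * S b) (S b * Tw * S b * Tw)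
  | r20 (a b c) (ha : a.val = 0) (hb : b.val = 1) (hc : c.val = 2) :
      YRel (Tw * (S b * S c * S a * S b) * Tw * (S b * S c * S a * S b))
           (S b * S c * S a * S b * Tw * (S b * S c * S a * S b) * Tw)
  | r21 (a b) (ha : a.val = 0) (hb : b.val = 1) :
      YRel (Tw * (S b * S a * Ew * S a * S b)) (S b * S a * Ew * S a * S b * Tw)

/-- The congruence `≈` on the free monoid `Y*` generated by relations (R11)–(R21). -/
def ycon (n : ℕ) : Con (FreeMonoid (YA n)) := conGen YRel

/-- The word `s_{i₁}⋯s_{i_k}` over the letters `s`. -/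
def sprod {n : ℕ} (L : List (Fin (n - 1))) : FreeMonoid (YA n) := (L.map S).prod

/-- The (0-based) list of indices of `c_r = s_1 s_2 ⋯ s_{r-1}`. -/
def cIdx (n : ℕ) (r : Fin n) : List (Fin (n - 1)) :=
  (List.finRange (n - 1)).filter (fun k => k.val < r.val)

/-- The word `c_r = s_1 s_2 ⋯ s_{r-1}`. -/
def cw {n : ℕ} (r : Fin n) : FreeMonoid (YA n) := sprod (cIdx n r)

/-- The word `c_r⁻¹ = s_{r-1} ⋯ s_2 s_1`. -/
def cwInv {n : ℕ} (r : Fin n) : FreeMonoid (YA n) := sprod (cIdx n r).reverse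

/-- The word `ε_r = c_r⁻¹ e c_r`. -/
def eps {n : ℕ} (r : Fin n) : FreeMonoid (YA n) := cwInv r * Ew * cw r

/-- The word `τ_{ij} = τ_{ji} = c_i⁻¹ c_j⁻¹ t c_j c_i` (for `i < j`), indexed symmetrically. -/
def tauw {n : ℕ} (i j : Fin n) : FreeMonoid (YA n) :=
  cwInv (min i j) * cwInv (max i j) * Tw * cw (max i j) * cw (min i j)

/-- The transposition `σ_k` of `{1,…,n}` interchanging `k` and `k+1`
(0-based: `sigma n k` swaps the elements of `Fin n` with values `k.val` and `k.val + 1`). -/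
def sigma (n : ℕ) (k : Fin (n - 1)) (r : Fin n) : Fin n :=
  if r.val = k.val then ⟨k.val + 1, by have := k.isLt; omega⟩
  else if r.val = k.val + 1 then ⟨k.val, by have := k.isLt; omega⟩
  else r

section AdjacentTranspositions

/-- The product `u 0 * u 1 * ⋯ * u (r - 1)`. -/
def cprod {G : Type*} [Group G] (u : ℕ → G) : ℕ → G
  | 0 => 1
  | r + 1 => cprod u r * u r

/-- The transposition of `k` and `k + 1` on `ℕ`. -/
def swapSucc (k r : ℕ) : ℕ := if r = k then k + 1 else if r = k + 1 then k else r

/-- The Coxeter relations of type `A` for a sequence in a group, with the braid relations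
imposed only on the first `N` terms. -/
structure IsCoxeterSeq {G : Type*} [Group G] (u : ℕ → G) (N : ℕ) : Prop where
  sq : ∀ k, u k * u k = 1
  comm : ∀ j k, j + 1 < k → u j * u k = u k * u j
  braid : ∀ k, k + 1 < N → u k * u (k + 1) * u k = u (k + 1) * u k * u (k + 1)

variable {G : Type*} [Group G] {u : ℕ → G} {N : ℕ}

theorem cprod_eq_prod (r : ℕ) : cprod u r = ((List.range r).map u).prod := by
  induction r with
  | zero => rfl
  | succ r ih => simp [List.range_succ, cprod, ih]

namespace IsCoxeterSeq

theorem cprod_mul_of_lt (hu : IsCoxeterSeq u N) {r k : ℕ} (h : r < k) :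
    cprod u r * u k = u k * cprod u r := by
  induction r with
  | zero => simp [cprod]
  | succ r ih =>
    rw [cprod, mul_assoc, hu.comm r k h, ← mul_assoc, ih (by omega), mul_assoc]

theorem cprod_succ_mul (hu : IsCoxeterSeq u N) (r : ℕ) : cprod u (r + 1) * u r = cprod u r := by
  rw [cprod, mul_assoc, hu.sq, mul_one]

theorem cprod_mul_of_succ_lt (hu : IsCoxeterSeq u N) {r k : ℕ} (h : k + 1 < r) (hr : r ≤ N) :
    cprod u r * u k = u (k + 1) * cprod u r := by
  induction r, h using Nat.le_induction with
  | base =>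
    have hb := hu.braid k (by omega)
    rw [cprod, cprod, mul_assoc, mul_assoc, ← mul_assoc (u k), hb, ← mul_assoc, ← mul_assoc,
      hu.cprod_mul_of_lt (by omega)]
    simp only [mul_assoc]
  | succ r hkr ih =>
    rw [cprod, mul_assoc, ← hu.comm k r hkr, ← mul_assoc, ih (by omega), mul_assoc]

theorem zero_mul_cprod_succ_mul_cprod (hu : IsCoxeterSeq u N) {r i : ℕ} (h : i < r) (hr : r ≤ N) :
    u 0 * (cprod u r * cprod u i) = cprod u (i + 1) * cprod u r := by
  induction i with
  | zero => simp [cprod]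
  | succ i ih =>
    rw [cprod, ← mul_assoc (cprod u r), ← mul_assoc, ih (by omega), mul_assoc,
      hu.cprod_mul_of_succ_lt h hr, ← mul_assoc, ← cprod]

end IsCoxeterSeq

end AdjacentTranspositions

section Conjugation

variable {M : Type*} [Monoid M]

/-- Conjugation of an element of a monoid by a unit. -/
def conjUnit (x : M) (g : Mˣ) : M := ↑g⁻¹ * x * ↑g

theorem conjUnit_mul (x : M) (g h : Mˣ) : conjUnit x (g * h) = ↑h⁻¹ * conjUnit x g * ↑h := by
  simp [conjUnit, mul_assoc]

theorem conjUnit_mul_of_commute {x : M} {h : Mˣ} (hc : Commute x ↑h) (g : Mˣ) :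
    conjUnit x (h * g) = conjUnit x g := by
  have : (↑h⁻¹ : M) * x * ↑h = x := by rw [mul_assoc, hc.eq, Units.inv_mul_cancel_left]
  rw [conjUnit_mul, conjUnit, this, conjUnit]

variable {u : ℕ → Mˣ} {N : ℕ}

theorem conjUnit_cprod_mul (hu : IsCoxeterSeq u N) {x : M}
    (hx : ∀ k, 1 ≤ k → Commute x ↑(u k)) {k r : ℕ} (hr : r ≤ N) :
    conjUnit x (cprod u r * u k) = conjUnit x (cprod u (swapSucc k r)) := by
  unfold swapSucc
  split_ifs with h1 h2
  · subst h1; rfl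
  · subst h2; rw [hu.cprod_succ_mul]
  · rcases lt_or_gt_of_ne h1 with h | h
    · rw [hu.cprod_mul_of_lt h, conjUnit_mul_of_commute (hx k (by omega))]
    · rw [hu.cprod_mul_of_succ_lt (by omega) hr, conjUnit_mul_of_commute (hx _ (by omega))]

/-- The conjugate of `x` by the unit attached to the unordered pair `{i, j}`. -/
def conjPair (u : ℕ → Mˣ) (x : M) (i j : ℕ) : M :=
  conjUnit x (cprod u (max i j) * cprod u (min i j))

theorem conjPair_comm (x : M) (i j : ℕ) : conjPair u x i j = conjPair u x j i := by
  rw [conjPair, conjPair, max_comm, min_comm]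

theorem conjPair_of_lt (x : M) {i j : ℕ} (h : i < j) :
    conjPair u x i j = conjUnit x (cprod u j * cprod u i) := by
  rw [conjPair, max_eq_right h.le, min_eq_left h.le]

theorem conjUnit_cprod_mul_cprod_mul (hu : IsCoxeterSeq u N) {x : M} (hx0 : Commute x ↑(u 0))
    (hx : ∀ k, 2 ≤ k → Commute x ↑(u k)) {k i j : ℕ} (hij : i < j) (hj : j ≤ N) :
    conjUnit x (cprod u j * cprod u i * u k) = conjPair u x (swapSucc k i) (swapSucc k j) := by
  rw [mul_assoc]
  rcases lt_trichotomy i k with hik | rfl | hki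
  · rw [hu.cprod_mul_of_lt hik, ← mul_assoc, show swapSucc k i = i by grind [swapSucc]]
    rcases lt_trichotomy j k with hjk | rfl | hkj
    · rw [hu.cprod_mul_of_lt hjk, mul_assoc, conjUnit_mul_of_commute (hx k (by omega)),
        show swapSucc k j = j by grind [swapSucc], conjPair_of_lt x hij]
    · rw [show swapSucc j j = j + 1 by grind [swapSucc], conjPair_of_lt x (by omega), cprod]
    · rcases (show k + 1 ≤ j from hkj).eq_or_lt with rfl | hkj'
      · rw [hu.cprod_succ_mul, show swapSucc k (k + 1) = k by grind [swapSucc],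
          conjPair_of_lt x hik]
      · rw [hu.cprod_mul_of_succ_lt hkj' hj, mul_assoc,
          conjUnit_mul_of_commute (hx _ (by omega)),
          show swapSucc k j = j by grind [swapSucc], conjPair_of_lt x hij]
  · rw [← cprod, show swapSucc i i = i + 1 by grind [swapSucc]]
    rcases (show i + 1 ≤ j from hij).eq_or_lt with rfl | hij'
    · rw [show swapSucc i (i + 1) = i by grind [swapSucc], conjPair_comm,
        conjPair_of_lt x hij, ← hu.zero_mul_cprod_succ_mul_cprod hij hj,
        conjUnit_mul_of_commute hx0]
    · rw [show swapSucc i j = j by grind [swapSucc], conjPair_of_lt x hij']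
  · rw [show swapSucc k j = j by grind [swapSucc]]
    rcases (show k + 1 ≤ i from hki).eq_or_lt with rfl | hki'
    · rw [hu.cprod_succ_mul, show swapSucc k (k + 1) = k by grind [swapSucc],
        conjPair_of_lt x (by omega)]
    · rw [hu.cprod_mul_of_succ_lt hki' (by omega), ← mul_assoc,
        hu.cprod_mul_of_succ_lt (by omega) hj, mul_assoc,
        conjUnit_mul_of_commute (hx _ (by omega)),
        show swapSucc k i = i by grind [swapSucc], conjPair_of_lt x hij]

theorem inv_mul_conjPair_mul (hu : IsCoxeterSeq u N) {x : M} (hx0 : Commute x ↑(u 0))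
    (hx : ∀ k, 2 ≤ k → Commute x ↑(u k)) {k i j : ℕ} (hij : i ≠ j) (hi : i ≤ N) (hj : j ≤ N) :
    ↑(u k)⁻¹ * conjPair u x i j * ↑(u k) = conjPair u x (swapSucc k i) (swapSucc k j) := by
  rcases lt_or_gt_of_ne hij with h | h
  · rw [conjPair_of_lt x h, ← conjUnit_mul, conjUnit_cprod_mul_cprod_mul hu hx0 hx h hj]
  · rw [conjPair_comm, conjPair_of_lt x h, ← conjUnit_mul,
      conjUnit_cprod_mul_cprod_mul hu hx0 hx h hi, conjPair_comm]

end Conjugation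

section Quotient

variable {n : ℕ}

theorem YRel.mk_eq {x y : FreeMonoid (YA n)} (h : YRel x y) :
    (x : (ycon n).Quotient) = (y : (ycon n).Quotient) :=
  (Con.eq _).2 (ConGen.Rel.of _ _ h)

/-- The image of the letter `s i` in the quotient, as a unit. -/
def sUnit (i : Fin (n - 1)) : (ycon n).Quotientˣ :=
  ⟨(S i : FreeMonoid (YA n)), (S i : FreeMonoid (YA n)), (YRel.r11 i).mk_eq, (YRel.r11 i).mk_eq⟩

/-- The sequence of the units `sUnit`, continued by `1`. -/
def sSeq (n k : ℕ) : (ycon n).Quotientˣ := if h : k < n - 1 then sUnit ⟨k, h⟩ else 1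

theorem sSeq_val (i : Fin (n - 1)) : sSeq n i = sUnit i := by simp [sSeq]

theorem isCoxeterSeq_sSeq : IsCoxeterSeq (sSeq n) (n - 1) where
  sq k := by
    unfold sSeq
    split_ifs with h
    · exact Units.ext (YRel.r11 _).mk_eq
    · simp
  comm j k h := by
    unfold sSeq
    split_ifs with h1 h2
    · exact Units.ext (YRel.r12 _ _ (.inl h)).mk_eq
    all_goals simp
  braid k h := by
    rw [sSeq, sSeq, dif_pos h, dif_pos (by omega)]
    exact Units.ext (YRel.r13 _ _ (.inl rfl)).mk_eq

theorem commute_sSeq {x : FreeMonoid (YA n)} {k : ℕ}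
    (h : ∀ i : Fin (n - 1), i.val = k →
      ((x * S i : FreeMonoid (YA n)) : (ycon n).Quotient) = (S i * x : FreeMonoid (YA n))) :
    Commute (x : (ycon n).Quotient) ↑(sSeq n k) := by
  unfold sSeq
  split_ifs with hk
  · exact h ⟨k, hk⟩ rfl
  · exact Commute.one_right _

theorem commute_Ew_sSeq {k : ℕ} (hk : 1 ≤ k) :
    Commute ((Ew : FreeMonoid (YA n)) : (ycon n).Quotient) ↑(sSeq n k) :=
  commute_sSeq fun i hi => (YRel.r16 i (hi ▸ hk)).mk_eq

theorem commute_Tw_sSeq {k : ℕ} (hk : 2 ≤ k) :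
    Commute ((Tw : FreeMonoid (YA n)) : (ycon n).Quotient) ↑(sSeq n k) :=
  commute_sSeq fun i hi => (YRel.r17 i (hi ▸ hk)).mk_eq

theorem commute_Tw_sSeq_zero :
    Commute ((Tw : FreeMonoid (YA n)) : (ycon n).Quotient) ↑(sSeq n 0) :=
  commute_sSeq fun i hi => (YRel.r15c i hi).mk_eq.trans (YRel.r15d i hi).mk_eq.symm

theorem mk_sprod (L : List (Fin (n - 1))) :
    ((sprod L : FreeMonoid (YA n)) : (ycon n).Quotient) = ↑(L.map sUnit).prod := by
  induction L with
  | nil => rfl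
  | cons k L ih =>
    rw [List.map_cons, List.prod_cons, Units.val_mul, ← ih]
    rfl

theorem mk_sprod_reverse (L : List (Fin (n - 1))) :
    ((sprod L.reverse : FreeMonoid (YA n)) : (ycon n).Quotient) = ↑(L.map sUnit).prod⁻¹ := by
  rw [mk_sprod, List.prod_inv_reverse, List.map_reverse, List.map_map]
  rfl

theorem map_val_cIdx (r : Fin n) : (cIdx n r).map Fin.val = List.range r := by
  have h : ∀ m : ℕ, (List.range m).filter (· < r.val) = List.range (min r m) := by
    intro m
    induction m with
    | zero => simp
    | succ m ih =>
      rw [List.range_succ, List.filter_append, ih]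
      by_cases hm : m < r.val
      · rw [min_eq_right hm.le, min_eq_right (show m + 1 ≤ r.val from hm), List.range_succ]
        simp [hm]
      · rw [min_eq_left (by omega), min_eq_left (by omega)]
        simp [hm]
  have hr : min r.val (n - 1) = r.val := by omega
  rw [← hr, ← h, ← List.map_coe_finRange_eq_range, List.filter_map]
  rfl

theorem prod_map_sUnit_cIdx (r : Fin n) : ((cIdx n r).map sUnit).prod = cprod (sSeq n) r := by
  rw [cprod_eq_prod, ← map_val_cIdx, List.map_map]
  congr 2
  funext i
  exact (sSeq_val i).symm

theorem mk_eps (r : Fin n) : ((eps r : FreeMonoid (YA n)) : (ycon n).Quotient) =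
    conjUnit ((Ew : FreeMonoid (YA n)) : (ycon n).Quotient) (cprod (sSeq n) r) := by
  rw [eps, Con.coe_mul, Con.coe_mul, cwInv, cw, mk_sprod_reverse, mk_sprod, prod_map_sUnit_cIdx,
    conjUnit]

theorem mk_tauw (i j : Fin n) : ((tauw i j : FreeMonoid (YA n)) : (ycon n).Quotient) =
    conjPair (sSeq n) ((Tw : FreeMonoid (YA n)) : (ycon n).Quotient) i j := by
  simp only [tauw, Con.coe_mul, cwInv, cw, mk_sprod_reverse]
  simp only [mk_sprod, prod_map_sUnit_cIdx, conjPair, conjUnit, mul_inv_rev, Units.val_mul,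
    mul_assoc, Fin.coe_max, Fin.coe_min]

theorem sigma_val (k : Fin (n - 1)) (r : Fin n) : (sigma n k r).val = swapSucc k r := by
  unfold sigma swapSucc
  split_ifs <;> rfl

theorem sigma_injective (k : Fin (n - 1)) : Function.Injective (sigma n k) := by
  intro i j h
  have h := congrArg Fin.val h
  rw [sigma_val, sigma_val] at h
  grind [swapSucc]

theorem inv_mul_mk_eps_mul (k : Fin (n - 1)) (r : Fin n) :
    ↑(sUnit k)⁻¹ * ((eps r : FreeMonoid (YA n)) : (ycon n).Quotient) * ↑(sUnit k) =
      (eps (sigma n k r) : FreeMonoid (YA n)) := by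
  rw [mk_eps, mk_eps, sigma_val, ← sSeq_val, ← conjUnit_mul]
  exact conjUnit_cprod_mul isCoxeterSeq_sSeq (fun _ => commute_Ew_sSeq) (by omega)

theorem inv_mul_mk_tauw_mul (k : Fin (n - 1)) {i j : Fin n} (h : i ≠ j) :
    ↑(sUnit k)⁻¹ * ((tauw i j : FreeMonoid (YA n)) : (ycon n).Quotient) * ↑(sUnit k) =
      (tauw (sigma n k i) (sigma n k j) : FreeMonoid (YA n)) := by
  rw [mk_tauw, mk_tauw, sigma_val, sigma_val, ← sSeq_val]
  exact inv_mul_conjPair_mul isCoxeterSeq_sSeq commute_Tw_sSeq_zero (fun _ => commute_Tw_sSeq)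
    (Fin.val_ne_of_ne h) (by omega) (by omega)

theorem mk_sprod_reverse_mul_mul_sprod_cons (k : Fin (n - 1)) (L : List (Fin (n - 1)))
    (x : FreeMonoid (YA n)) :
    ((sprod (k :: L).reverse * x * sprod (k :: L) : FreeMonoid (YA n)) : (ycon n).Quotient) =
      (sprod L.reverse : FreeMonoid (YA n)) * (↑(sUnit k)⁻¹ * (x : (ycon n).Quotient) * ↑(sUnit k))
        * (sprod L : FreeMonoid (YA n)) := by
  simp only [Con.coe_mul, mk_sprod_reverse]
  simp only [mk_sprod, List.map_cons, List.prod_cons, mul_inv_rev, Units.val_mul, mul_assoc]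

end Quotient

/-- Corollary wewwtw: for a word `w = s_{i₁}⋯s_{i_k}` with associated
permutation `π` (applying `σ_{i₁}` first, then `σ_{i₂}`, …), we have
`w⁻¹ ε_r w ≈ ε_{π(r)}` and `w⁻¹ τ_{ij} w ≈ τ_{π(i), π(j)}`. -/
theorem stmt12 (n : ℕ) (hn : 2 ≤ n) (L : List (Fin (n - 1))) :
    (∀ r : Fin n, ycon n (sprod L.reverse * eps r * sprod L)
      (eps (L.foldl (fun x k => sigma n k x) r))) ∧
    (∀ i j : Fin n, i < j → ycon n (sprod L.reverse * tauw i j * sprod L)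
      (tauw (L.foldl (fun x k => sigma n k x) i) (L.foldl (fun x k => sigma n k x) j))) := by
  refine ⟨fun r => (Con.eq _).1 ?_, fun i j hij => (Con.eq _).1 ?_⟩
  · induction L generalizing r with
    | nil => simp [sprod]
    | cons k L ih =>
      rw [mk_sprod_reverse_mul_mul_sprod_cons, inv_mul_mk_eps_mul, ← Con.coe_mul, ← Con.coe_mul, ih,
        List.foldl_cons]
  · replace hij := hij.ne
    induction L generalizing i j with
    | nil => simp [sprod]
    | cons k L ih =>
      rw [mk_sprod_reverse_mul_mul_sprod_cons, inv_mul_mk_tauw_mul k hij, ← Con.coe_mul,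
        ← Con.coe_mul, ih _ _ ((sigma_injective k).ne hij), List.foldl_cons, List.foldl_cons]
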